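/- arXiv:1705.02129 — 5 statements merged into one kernel-verified Lean document; each statement's English description precedes it below -/
import Mathlib

section
/- Let Π be a group, ρ : Π → SL(2,ℤ) a group homomorphism, and χ : Π → {1,−1} a group homomorphism, with G₁ = im(ρ) and G₂ = im(g ↦ χ(g)·ρ(g)). If G₁ = SL(2,ℤ), then G₂ = SL(2,ℤ). -/
/-- **Proposition 4.6(ii).** With `G₁ = im ρ` and `G₂ = im (g ↦ χ(g)·ρ(g))`:
if `G₁ = SL(2,ℤ)` then `G₂ = SL(2,ℤ)`. -/
theorem stmt_2 {P : Type*} [Group P]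
    (ρ ρ' : P →* Matrix.SpecialLinearGroup (Fin 2) ℤ) (χ : P →* ℤˣ)
    (hρ' : ∀ g : P, (ρ' g : Matrix (Fin 2) (Fin 2) ℤ)
      = ((χ g : ℤ)) • ((ρ g : Matrix (Fin 2) (Fin 2) ℤ)))
    (h₁ : ρ.range = ⊤) :
    ρ'.range = ⊤ := by
  have sign (g : P) : ρ' g = ρ g ∨ ρ' g = -ρ g := by
    rcases Int.units_eq_one_or (χ g) with h | h
    · exact Or.inl (Subtype.ext (by simp [hρ', h]))
    · exact Or.inr (Subtype.ext (by simp [hρ', h]))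
  rw [MonoidHom.range_eq_top] at h₁ ⊢
  -- A sign change does not affect `S ^ 2 = -1`, so `-1` lies in the image of `ρ'`.
  obtain ⟨s, hs⟩ := h₁ ModularGroup.S
  have hS : ModularGroup.S * ModularGroup.S = -1 := by decide
  have neg_one : ρ' (s * s) = -1 := by
    rcases sign s with h | h <;> simp [h, hs, hS]
  intro A
  obtain ⟨g, rfl⟩ := h₁ A
  rcases sign g with h | h
  · exact ⟨g, h⟩
  · exact ⟨s * s * g, by rw [map_mul, neg_one, h, neg_mul_neg, one_mul]⟩
end

section
/- Let Π be a group, ρ : Π → SL(2,ℤ) a group homomorphism, and χ : Π → {1,−1} a group homomorphism, with G₁ = im(ρ) and G₂ = im(g ↦ χ(g)·ρ(g)). Then: (i) if G₁ has finite index in SL(2,ℤ), then G₂ also has finite index, and either the indices (SL(2,ℤ) : G₁) and (SL(2,ℤ) : G₂) are equal, or one of them is exactly twice the other; (ii) the images of G₁ and G₂ under the quotient map SL(2,ℤ) → SL(2,ℤ)/{±I} coincide. -/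
/-- Adjoining a normal subgroup of the form `{1, z}` to `H` enlarges `H` by index `1` or `2`. -/
theorem Subgroup.relIndex_sup_eq_one_or_two {G : Type*} [Group G] (H N : Subgroup G) [N.Normal]
    {z : G} (hN : ∀ x, x ∈ N ↔ x = 1 ∨ x = z) :
    H.relIndex (H ⊔ N) = 1 ∨ H.relIndex (H ⊔ N) = 2 := by
  have hzN : z ∈ N := (hN z).2 (Or.inr rfl)
  by_cases hz : z ∈ H
  · left
    have hle : N ≤ H := fun x hx => by
      rcases (hN x).1 hx with rfl | rfl
      exacts [H.one_mem, hz]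
    rw [sup_eq_left.2 hle, Subgroup.relIndex_self]
  · right
    have hz1 : z ≠ 1 := fun h => hz (h ▸ H.one_mem)
    have hzz : z * z = 1 := by
      rcases (hN _).1 (N.mul_mem hzN hzN) with h | h
      exacts [h, absurd (mul_eq_left.1 h) hz1]
    rw [Subgroup.relIndex_eq_two_iff]
    refine ⟨z, Subgroup.mem_sup_right hzN, fun b hb => ?_⟩
    obtain ⟨y, hy, n, hn, rfl⟩ := Subgroup.mem_sup_of_normal_right.1 hb
    rcases (hN n).1 hn with rfl | rfl
    · exact Or.inr ⟨by simpa using hy, by simpa [H.mul_mem_cancel_left hy] using hz⟩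
    · exact Or.inl ⟨by simpa [mul_assoc, hzz] using hy, by simpa [H.mul_mem_cancel_left hy] using hz⟩

/-- **Corollary 4.7.** With `G₁ = im ρ` and `G₂ = im (g ↦ χ(g)·ρ(g))`:
(i) if `G₁` has finite index in `SL(2,ℤ)`, then so does `G₂`, and the two
indices are equal or one is twice the other; (ii) the images of `G₁` and `G₂`
under the quotient map `SL(2,ℤ) → SL(2,ℤ)/{±I}` coincide.  Here `N = {±I}`. -/
theorem stmt_3 {P : Type*} [Group P]
    (ρ ρ' : P →* Matrix.SpecialLinearGroup (Fin 2) ℤ) (χ : P →* ℤˣ)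
    (hρ' : ∀ g : P, (ρ' g : Matrix (Fin 2) (Fin 2) ℤ)
      = ((χ g : ℤ)) • ((ρ g : Matrix (Fin 2) (Fin 2) ℤ)))
    (N : Subgroup (Matrix.SpecialLinearGroup (Fin 2) ℤ)) [N.Normal]
    (hN : ∀ x : Matrix.SpecialLinearGroup (Fin 2) ℤ,
      x ∈ N ↔ x = 1 ∨ x = (-1 : Matrix.SpecialLinearGroup (Fin 2) ℤ)) :
    (ρ.range.index ≠ 0 →
      ρ'.range.index ≠ 0 ∧
        (ρ.range.index = ρ'.range.index
          ∨ ρ.range.index = 2 * ρ'.range.index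
          ∨ ρ'.range.index = 2 * ρ.range.index))
    ∧ ρ.range.map (QuotientGroup.mk' N) = ρ'.range.map (QuotientGroup.mk' N) := by
  have hcomp : (QuotientGroup.mk' N).comp ρ = (QuotientGroup.mk' N).comp ρ' := by
    ext g
    refine (QuotientGroup.mk'_eq_mk' N).2 ?_
    rcases Int.units_eq_one_or (χ g) with h | h
    · refine ⟨1, N.one_mem, Subtype.ext ?_⟩
      simp [hρ' g, h]
    · refine ⟨-1, (hN _).2 (Or.inr rfl), Subtype.ext ?_⟩
      simp [hρ' g, h]
  have hmap : ρ.range.map (QuotientGroup.mk' N) = ρ'.range.map (QuotientGroup.mk' N) := by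
    rw [MonoidHom.map_range, MonoidHom.map_range, hcomp]
  refine ⟨fun hfin => ?_, hmap⟩
  have hsup : ρ.range ⊔ N = ρ'.range ⊔ N := by
    simpa [Subgroup.comap_map_eq] using congrArg (Subgroup.comap (QuotientGroup.mk' N)) hmap
  have h₁ := Subgroup.relIndex_mul_index (le_sup_left : ρ.range ≤ ρ.range ⊔ N)
  have h₂ := Subgroup.relIndex_mul_index (le_sup_left : ρ'.range ≤ ρ'.range ⊔ N)
  rw [← hsup] at h₂
  have r₁ := ρ.range.relIndex_sup_eq_one_or_two N hN
  have r₂ := ρ'.range.relIndex_sup_eq_one_or_two N hN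
  rw [← hsup] at r₂
  rcases r₁ with r₁ | r₁ <;> rcases r₂ with r₂ | r₂ <;> rw [r₁] at h₁ <;> rw [r₂] at h₂ <;> omega
end

section
/- Let G be a subgroup of SL(2,ℤ) of finite index which can be generated by r elements, where r ≥ 2. Then (SL(2,ℤ) : G) ≤ 12(r − 1). -/
namespace Subgroup

/-- A choice of left coset representatives in which `H` is represented by `1`. -/
noncomputable def cosetRep {K : Type*} [Group K] (H : Subgroup K) (q : K ⧸ H) : K :=
  q.out * ((1 : K) : K ⧸ H).out⁻¹

variable {K : Type*} [Group K] (H : Subgroup K)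

lemma out_one_mem : ((1 : K) : K ⧸ H).out ∈ H := by
  have h := QuotientGroup.out_eq' ((1 : K) : K ⧸ H)
  have h' := QuotientGroup.eq.1 h.symm
  simpa using h'

@[simp]
lemma mk_cosetRep (q : K ⧸ H) : (H.cosetRep q : K ⧸ H) = q := by
  conv_rhs => rw [← QuotientGroup.out_eq' q]
  exact (QuotientGroup.eq.2 (by simpa [cosetRep] using H.out_one_mem)).symm

@[simp]
lemma cosetRep_one : H.cosetRep ((1 : K) : K ⧸ H) = 1 := by
  simp [cosetRep]

lemma cosetRep_smul_one (q : K ⧸ H) : H.cosetRep q • ((1 : K) : K ⧸ H) = q := by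
  simp

lemma cosetRep_inv_mul_mem (g : K) (q : K ⧸ H) :
    (H.cosetRep (g • q))⁻¹ * (g * H.cosetRep q) ∈ H := by
  rw [← QuotientGroup.eq, mk_cosetRep]
  conv_lhs => rw [← mk_cosetRep H q]
  rfl

/-- The element of `H` by which `g` moves the representative of `q`. -/
noncomputable def cosetCocycle (g : K) (q : K ⧸ H) : H :=
  ⟨(H.cosetRep (g • q))⁻¹ * (g * H.cosetRep q), H.cosetRep_inv_mul_mem g q⟩

lemma cosetCocycle_mul (g h : K) (q : K ⧸ H) :
    H.cosetCocycle (g * h) q = H.cosetCocycle g (h • q) * H.cosetCocycle h q := by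
  ext
  simp [cosetCocycle, mul_smul, mul_assoc]

lemma mem_smul_one {h : K} (hh : h ∈ H) : h • ((1 : K) : K ⧸ H) = ((1 : K) : K ⧸ H) :=
  (QuotientGroup.eq.2 (by simpa using hh)).symm

lemma cosetCocycle_coe_one (h : H) : H.cosetCocycle (h : K) ((1 : K) : K ⧸ H) = h := by
  ext
  rw [cosetCocycle]
  simp only [H.mem_smul_one h.2, cosetRep_one]
  simp

lemma cosetCocycle_cosetRep_one (q : K ⧸ H) :
    H.cosetCocycle (H.cosetRep q) ((1 : K) : K ⧸ H) = 1 := by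
  ext
  rw [cosetCocycle]
  simp only [cosetRep_smul_one, cosetRep_one]
  simp

end Subgroup

/-- A map `f : K → X → A` is a cocycle for the action of `K` on `X`. -/
def IsActionCocycle {K X A : Type*} [Group K] [MulAction K X] [CommGroup A] (f : K → X → A) :
    Prop :=
  ∀ g h x, f (g * h) x = f g (h • x) * f h x

namespace IsActionCocycle

variable {K X A : Type*} [Group K] [MulAction K X] [CommGroup A] {f f' : K → X → A}

lemma map_one (hf : IsActionCocycle f) (x : X) : f 1 x = 1 := by
  simpa using hf 1 1 x

lemma map_inv (hf : IsActionCocycle f) (g : K) (x : X) : f g⁻¹ x = (f g (g⁻¹ • x))⁻¹ := by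
  have h := hf g g⁻¹ x
  rw [mul_inv_cancel, hf.map_one] at h
  exact eq_inv_of_mul_eq_one_right h.symm

lemma eq_of_closure (hf : IsActionCocycle f) (hf' : IsActionCocycle f') {s : Set K}
    (hs : Subgroup.closure s = ⊤) (h : ∀ g ∈ s, f g = f' g) : f = f' := by
  funext g
  have hg : g ∈ Subgroup.closure s := hs ▸ Subgroup.mem_top g
  induction hg using Subgroup.closure_induction with
  | mem g hg => exact h g hg
  | one => funext x; rw [hf.map_one, hf'.map_one]
  | mul a b _ _ ha hb => funext x; rw [hf, hf', ha, hb]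
  | inv a _ ha => funext x; rw [hf.map_inv, hf'.map_inv, ha]

/-- The restriction of a cocycle to a stabilizer is a homomorphism. -/
def toHom {H : Subgroup K} {f : K → K ⧸ H → A} (hf : IsActionCocycle f) : H →* A where
  toFun h := f h ((1 : K) : K ⧸ H)
  map_one' := hf.map_one _
  map_mul' a b := by
    rw [Subgroup.coe_mul, hf, H.mem_smul_one b.2]

/-- A cocycle on a transitive action is determined by its restriction to a stabilizer and its
values on coset representatives. -/
lemma eq_toHom_mul {H : Subgroup K} {f : K → K ⧸ H → A} (hf : IsActionCocycle f) (g : K)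
    (q : K ⧸ H) :
    f g q = f (H.cosetRep (g • q)) ((1 : K) : K ⧸ H) * hf.toHom (H.cosetCocycle g q) *
      (f (H.cosetRep q) ((1 : K) : K ⧸ H))⁻¹ := by
  have h1 := hf g (H.cosetRep q) ((1 : K) : K ⧸ H)
  have h2 := hf (H.cosetRep (g • q)) (H.cosetCocycle g q) ((1 : K) : K ⧸ H)
  rw [H.mem_smul_one (H.cosetCocycle g q).2] at h2
  rw [H.cosetRep_smul_one] at h1
  have h3 : H.cosetRep (g • q) * (H.cosetCocycle g q : K) = g * H.cosetRep q := by
    simp [Subgroup.cosetCocycle]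
  rw [h3, h1] at h2
  rw [eq_mul_inv_iff_mul_eq, h2]
  rfl

/-- The cocycle induced from a homomorphism on a stabilizer and a coboundary. -/
lemma of_hom {H : Subgroup K} (φ : H →* A) (u : K ⧸ H → A) :
    IsActionCocycle fun g q ↦ φ (H.cosetCocycle g q) * (u (g • q) * (u q)⁻¹) := by
  intro g h q
  simp only [H.cosetCocycle_mul, _root_.map_mul, mul_smul]
  rw [eq_comm, mul_mul_mul_comm, mul_assoc (u _), inv_mul_cancel_left]

end IsActionCocycle

/-- A family of functions on `X` indexed by free generators gives a permutation of `X × A`. -/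
def FreeGroup.cocyclePerm {ι X A : Type*} [MulAction (FreeGroup ι) X] [CommGroup A]
    (c : ι → X → A) : FreeGroup ι →* Equiv.Perm (X × A) :=
  FreeGroup.lift fun i ↦
    { toFun := fun p ↦ (FreeGroup.of i • p.1, c i p.1 * p.2)
      invFun := fun p ↦ ((FreeGroup.of i)⁻¹ • p.1, (c i ((FreeGroup.of i)⁻¹ • p.1))⁻¹ * p.2)
      left_inv := fun p ↦ by simp
      right_inv := fun p ↦ by simp }

lemma FreeGroup.cocyclePerm_apply {ι X A : Type*} [MulAction (FreeGroup ι) X] [CommGroup A]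
    (c : ι → X → A) (g : FreeGroup ι) (x : X) (a : A) :
    FreeGroup.cocyclePerm c g (x, a) = (g • x, (FreeGroup.cocyclePerm c g (x, 1)).2 * a) := by
  induction g using FreeGroup.induction_on generalizing x a with
  | C1 => simp
  | of i => simp [cocyclePerm]
  | inv_of i _ =>
    simp [cocyclePerm, Equiv.Perm.inv_def]
  | mul g h hg hh =>
    rw [_root_.map_mul, Equiv.Perm.mul_apply, Equiv.Perm.mul_apply, hh, hg, hh x 1,
      hg _ (_ * 1), mul_smul]
    simp [mul_assoc]

/-- Cocycles on a free group can be prescribed freely on the generators. -/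
lemma FreeGroup.exists_cocycle {ι X A : Type*} [MulAction (FreeGroup ι) X] [CommGroup A]
    (c : ι → X → A) :
    ∃ f : FreeGroup ι → X → A, IsActionCocycle f ∧ ∀ i, f (FreeGroup.of i) = c i := by
  refine ⟨fun g x ↦ (cocyclePerm c g (x, 1)).2, fun g h x ↦ ?_, fun i ↦ ?_⟩
  · simp only [_root_.map_mul, Equiv.Perm.mul_apply]
    rw [cocyclePerm_apply c h, cocyclePerm_apply c g]
  · funext x
    simp [cocyclePerm]

section Counting

variable {K A : Type*} [Group K] [CommGroup A]

/-- A pair of a homomorphism on `H` and a function on `K ⧸ H` is determined by the values of the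
associated cocycle on generators, together with one value of the function. -/
lemma Subgroup.exists_injective_hom_prod (H : Subgroup K) {s : Set K}
    (hs : Subgroup.closure s = ⊤) :
    ∃ F : (H →* A) × (K ⧸ H → A) → (s → K ⧸ H → A) × A, Function.Injective F := by
  refine ⟨fun p ↦ (fun g q ↦ p.1 (H.cosetCocycle g q) * (p.2 ((g : K) • q) * (p.2 q)⁻¹),
    p.2 ((1 : K) : K ⧸ H)), ?_⟩
  rintro ⟨φ, u⟩ ⟨ψ, v⟩ h
  simp only [Prod.mk.injEq] at h
  obtain ⟨h, h1⟩ := h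
  have key := (IsActionCocycle.of_hom φ u).eq_of_closure (IsActionCocycle.of_hom ψ v) hs
    fun g hg ↦ congrFun h ⟨g, hg⟩
  have hu : u = v := by
    funext q
    have := congrFun (congrFun key (H.cosetRep q)) ((1 : K) : K ⧸ H)
    simpa only [H.cosetCocycle_cosetRep_one, map_one, one_mul, H.cosetRep_smul_one, h1,
      mul_left_inj] using this
  subst hu
  have hφ : φ = ψ := by
    ext x
    have := congrFun (congrFun key x) ((1 : K) : K ⧸ H)
    simpa only [H.cosetCocycle_coe_one, mul_left_inj] using this
  rw [hφ]

/-- A cocycle on a free group, given by its values on the generators, is determined by its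
restriction to `H` and its values on coset representatives. -/
lemma FreeGroup.exists_injective_prod_hom {ι : Type*} (H : Subgroup (FreeGroup ι)) :
    ∃ F : (ι → FreeGroup ι ⧸ H → A) × A → (H →* A) × (FreeGroup ι ⧸ H → A),
      Function.Injective F := by
  choose f hf hfc using
    fun c : ι → FreeGroup ι ⧸ H → A ↦ FreeGroup.exists_cocycle c
  refine ⟨fun p ↦ ((hf p.1).toHom,
    fun q ↦ f p.1 (H.cosetRep q) ((1 : FreeGroup ι) : FreeGroup ι ⧸ H) * p.2), ?_⟩
  rintro ⟨c, a⟩ ⟨d, b⟩ h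
  simp only [Prod.mk.injEq] at h
  obtain ⟨h, h1⟩ := h
  have hab : a = b := by
    have := congrFun h1 ((1 : FreeGroup ι) : FreeGroup ι ⧸ H)
    simpa [(hf c).map_one, (hf d).map_one] using this
  subst hab
  have h2 : ∀ q, f c (H.cosetRep q) ((1 : FreeGroup ι) : FreeGroup ι ⧸ H) =
      f d (H.cosetRep q) ((1 : FreeGroup ι) : FreeGroup ι ⧸ H) :=
    fun q ↦ mul_right_cancel (congrFun h1 q)
  have hcd : c = d := by
    funext i q
    rw [← hfc c, ← hfc d, (hf c).eq_toHom_mul, (hf d).eq_toHom_mul, h, h2, h2]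
  rw [hcd]

end Counting

/-- If a finite index subgroup of a free group is isomorphic to a finite index subgroup of a
finitely generated group, then the indices and numbers of generators satisfy the inequality
given by Schreier's formula. -/
theorem FreeGroup.index_mul_le_of_mulEquiv {ι K : Type*} [Finite ι] [Group K]
    (H : Subgroup (FreeGroup ι)) [H.FiniteIndex] (L : Subgroup K) [L.FiniteIndex] (e : H ≃* L)
    {s : Set K} [Finite s] (hs : Subgroup.closure s = ⊤) :
    Nat.card ι * H.index + L.index ≤ Nat.card s * L.index + H.index := by
  let A := Multiplicative (ZMod 2)
  have hA : Nat.card A = 2 := Nat.card_zmod 2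
  have : Finite A := inferInstanceAs (Finite (ZMod 2))
  obtain ⟨F, hF⟩ := Subgroup.exists_injective_hom_prod (A := A) L hs
  obtain ⟨E, hE⟩ := FreeGroup.exists_injective_prod_hom (A := A) H
  have : Finite ((L →* A) × (K ⧸ L → A)) := Finite.of_injective F hF
  have : Finite (L →* A) := Finite.of_surjective (Prod.fst : (L →* A) × (K ⧸ L → A) → _)
    Prod.fst_surjective
  let e' : (H →* A) ≃ (L →* A) := e.monoidHomCongrLeftEquiv
  have : Finite (H →* A) := Finite.of_equiv _ e'.symm
  have h1 := Nat.card_le_card_of_injective F hF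
  have h2 := Nat.card_le_card_of_injective E hE
  simp only [Nat.card_prod, Nat.card_fun, hA, ← pow_mul, ← Subgroup.index_eq_card,
    Nat.card_congr e'] at h1 h2
  have h3 : 2 ^ (Nat.card ι * H.index + L.index) * 2 ≤
      2 ^ (Nat.card s * L.index + H.index) * 2 := by
    calc _ = 2 ^ (H.index * Nat.card ι) * 2 * 2 ^ L.index := by ring
      _ ≤ Nat.card (L →* A) * 2 ^ H.index * 2 ^ L.index := Nat.mul_le_mul_right _ h2
      _ = Nat.card (L →* A) * 2 ^ L.index * 2 ^ H.index := by ring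
      _ ≤ 2 ^ (L.index * Nat.card s) * 2 * 2 ^ H.index := Nat.mul_le_mul_right _ h1
      _ = _ := by ring
  exact (Nat.pow_le_pow_iff_right one_lt_two).1 (Nat.le_of_mul_le_mul_right h3 two_pos)

open scoped Pointwise in
/-- If left multiplication by generators maps a finite union of left cosets of `F` to itself, then
this union is the whole group. -/
lemma Subgroup.index_le_of_closure {K : Type*} [Group K] (F : Subgroup K) {s : Set K}
    (hs : Subgroup.closure s = ⊤) (R : Finset K) (h1 : 1 ∈ R)
    (hR : ∀ g ∈ s, ∀ x ∈ R, ∃ y ∈ R, ∃ f ∈ F, g * x = y * f) :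
    F.index ≠ 0 ∧ F.index ≤ R.card := by
  let Q : Set (K ⧸ F) := (fun x : K ↦ (x : K ⧸ F)) '' R
  have hQ : Q.Finite := R.finite_toSet.image _
  have hstab : MulAction.stabilizer K Q = ⊤ := by
    rw [eq_top_iff, ← hs, Subgroup.closure_le]
    intro g hg
    rw [SetLike.mem_coe, MulAction.mem_stabilizer_set_iff_smul_set_subset hQ]
    rintro _ ⟨_, ⟨x, hx, rfl⟩, rfl⟩
    obtain ⟨y, hy, f, hf, h⟩ := hR g hg x hx
    refine ⟨y, hy, QuotientGroup.eq.2 ?_⟩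
    simpa [h] using hf
  have huniv : Q = Set.univ := by
    refine Set.eq_univ_of_forall fun q ↦ ?_
    obtain ⟨g, rfl⟩ := QuotientGroup.mk_surjective q
    have hg : g ∈ MulAction.stabilizer K Q := hstab ▸ Subgroup.mem_top g
    rw [← MulAction.mem_stabilizer_iff.1 hg]
    exact ⟨_, ⟨1, h1, rfl⟩, by simp⟩
  have hfin : Finite (K ⧸ F) := Set.finite_univ_iff.1 (huniv ▸ hQ)
  refine ⟨Nat.card_pos.ne', ?_⟩
  rw [Subgroup.index_eq_card, ← Set.ncard_univ, ← huniv, ← Set.ncard_coe_finset R]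
  exact Set.ncard_image_le R.finite_toSet

namespace ModularGroup

open Matrix UpperHalfPlane MatrixGroups
open scoped Pointwise

/-- The matrices `!![1, 2; 0, 1]` and `!![1, 0; 2, 1]`, which freely generate a subgroup of index
`12`. -/
def sanovGen (b : Bool) : SL(2, ℤ) :=
  cond b (S⁻¹ * T ^ (-2 : ℤ) * S) (T ^ (2 : ℤ))

lemma abs_re_lt_one_or_S_smul (z : ℍ) : |z.re| < 1 ∨ |(S • z).re| < 1 := by
  by_contra! h
  obtain ⟨h1, h2⟩ := h
  have hz := z.im_pos
  have hre : (S • z).re = -z.re / (z.re ^ 2 + z.im ^ 2) := by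
    rw [modular_S_smul, ← coe_re, coe_mk, Complex.inv_re, Complex.normSq_apply]
    simp [sq]
  have hpos : 0 < z.re ^ 2 + z.im ^ 2 := by positivity
  rw [hre, abs_div, abs_neg, abs_of_pos hpos, one_le_div hpos, ← sq_abs z.re] at h2
  nlinarith

lemma sanovGen_lift_injective : Function.Injective (FreeGroup.lift sanovGen) := by
  have hS (z : ℍ) : S • sanovGen true • z = T ^ (-2 : ℤ) • S • z := by
    simp [sanovGen, mul_smul]
  have hS' (z : ℍ) : S • (sanovGen true)⁻¹ • z = T ^ (2 : ℤ) • S • z := by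
    simp [sanovGen, mul_smul]
  let X (b : Bool) : Set ℍ := cond b {z | (S • z).re ≤ -1} {z | 1 ≤ z.re}
  let Y (b : Bool) : Set ℍ := cond b {z | 1 < (S • z).re} {z | z.re < -1}
  refine FreeGroup.injective_lift_of_ping_pong sanovGen X Y ?_ ?_ ?_ ?_ ?_ ?_
  · have h : (T ^ (1 : ℤ) • I).re = 1 := by rw [re_T_zpow_smul]; simp
    have h' : (T ^ (-1 : ℤ) • I).re = -1 := by rw [re_T_zpow_smul]; simp
    rintro (_ | _)
    · exact ⟨T ^ (1 : ℤ) • I, h.ge⟩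
    · exact ⟨S⁻¹ • T ^ (-1 : ℤ) • I, by
        simp only [X, cond_true, Set.mem_ofPred_eq, smul_inv_smul, h', le_refl]⟩
  · rintro (_ | _) (_ | _) h <;> first | exact absurd rfl h | skip
    all_goals
      refine Set.disjoint_left.2 fun z hz hz' ↦ ?_
      simp only [X, cond_true, cond_false, Set.mem_ofPred_eq] at hz hz'
      rcases abs_re_lt_one_or_S_smul z with h | h <;> rw [abs_lt] at h <;> linarith
  · rintro (_ | _) (_ | _) h <;> first | exact absurd rfl h | skip
    all_goals
      refine Set.disjoint_left.2 fun z hz hz' ↦ ?_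
      simp only [Y, cond_true, cond_false, Set.mem_ofPred_eq] at hz hz'
      rcases abs_re_lt_one_or_S_smul z with h | h <;> rw [abs_lt] at h <;> linarith
  · rintro (_ | _) (_ | _)
    all_goals
      refine Set.disjoint_left.2 fun z hz hz' ↦ ?_
      simp only [X, Y, cond_true, cond_false, Set.mem_ofPred_eq] at hz hz'
      rcases abs_re_lt_one_or_S_smul z with h | h <;> rw [abs_lt] at h <;> linarith
  · rintro (_ | _) _ ⟨z, hz, rfl⟩
    · simp only [X, Y, cond_false, Set.mem_compl_iff, Set.mem_ofPred_eq, not_lt] at hz ⊢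
      change 1 ≤ (T ^ (2 : ℤ) • z).re
      rw [re_T_zpow_smul]
      push_cast
      linarith
    · simp only [X, Y, cond_true, Set.mem_compl_iff, Set.mem_ofPred_eq, not_lt] at hz ⊢
      rw [hS, re_T_zpow_smul]
      push_cast
      linarith
  · rintro (_ | _) _ ⟨z, hz, rfl⟩
    · simp only [X, Y, cond_false, Set.mem_compl_iff, Set.mem_ofPred_eq, not_le] at hz ⊢
      change ((T ^ (2 : ℤ))⁻¹ • z).re < -1
      rw [← _root_.zpow_neg, re_T_zpow_smul]
      push_cast
      linarith
    · simp only [X, Y, cond_true, Set.mem_compl_iff, Set.mem_ofPred_eq, not_le] at hz ⊢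
      rw [Pi.inv_apply, hS', re_T_zpow_smul]
      push_cast
      linarith

/-- Representatives of the left cosets of the subgroup generated by `sanovGen`. -/
def sanovReps : Finset SL(2, ℤ) :=
  let U : SL(2, ℤ) := ⟨!![1, 0; 1, 1], by simp⟩
  {1, S, T, S * T, T * S, U, -1, -S, -T, -(S * T), -(T * S), -U}

/-- Some elements of the subgroup generated by `sanovGen`. -/
def sanovWords : Finset (FreeGroup Bool) :=
  {1, .of false, .of true, (.of true)⁻¹, (.of false)⁻¹ * .of true}

lemma sanovReps_closed : ∀ g ∈ ({S, T} : Finset SL(2, ℤ)), ∀ x ∈ sanovReps, ∃ y ∈ sanovReps,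
    ∃ w ∈ sanovWords, g * x = y * FreeGroup.lift sanovGen w := by
  decide

lemma sanov_index : (FreeGroup.lift sanovGen).range.index ≠ 0 ∧
    (FreeGroup.lift sanovGen).range.index ≤ 12 := by
  have h := Subgroup.index_le_of_closure (FreeGroup.lift sanovGen).range
    SpecialLinearGroup.SL2Z_generators sanovReps (by decide) fun g hg x hx ↦ by
      obtain ⟨y, hy, w, -, h⟩ := sanovReps_closed g (by simpa using hg) x hx
      exact ⟨y, hy, _, ⟨w, rfl⟩, h⟩
  exact ⟨h.1, h.2.trans (by decide)⟩

end ModularGroup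

/-- **Lemma 5.7.** If `G ⊆ SL(2,ℤ)` is a subgroup of finite index that can be
generated by `r ≥ 2` elements, then `(SL(2,ℤ) : G) ≤ 12(r-1)`. -/
theorem stmt_6 (G : Subgroup (Matrix.SpecialLinearGroup (Fin 2) ℤ))
    (hfin : G.index ≠ 0) (r : ℕ) (hr : 2 ≤ r)
    (S : Finset (Matrix.SpecialLinearGroup (Fin 2) ℤ))
    (hS : ↑S ⊆ (G : Set (Matrix.SpecialLinearGroup (Fin 2) ℤ)))
    (hcard : S.card ≤ r)
    (hgen : Subgroup.closure (S : Set (Matrix.SpecialLinearGroup (Fin 2) ℤ)) = G) :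
    G.index ≤ 12 * (r - 1) := by
  have hF := ModularGroup.sanovGen_lift_injective
  obtain ⟨hc0, hc⟩ := ModularGroup.sanov_index
  set ψ := FreeGroup.lift ModularGroup.sanovGen
  have : G.FiniteIndex := ⟨hfin⟩
  have : ψ.range.FiniteIndex := ⟨hc0⟩
  have : (G.comap ψ).FiniteIndex := ⟨by
    rw [Subgroup.index_comap]
    exact fun h ↦ hfin (Subgroup.index_eq_zero_of_relIndex_eq_zero h)⟩
  have : (ψ.range.subgroupOf G).FiniteIndex := inferInstance
  let e : G.comap ψ ≃* ψ.range.subgroupOf G :=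
    ((G.comap ψ).equivMapOfInjective ψ hF).trans
      ((MulEquiv.subgroupCongr
        (by rw [Subgroup.map_comap_eq, Subgroup.subgroupOf_map_subtype])).trans
        ((ψ.range.subgroupOf G).equivMapOfInjective G.subtype G.subtype_injective).symm)
  let s : Set G := {g | (g : Matrix.SpecialLinearGroup (Fin 2) ℤ) ∈ S}
  have hcl : Subgroup.closure s = ⊤ := by
    subst hgen
    exact Subgroup.closure_closure_coe_preimage
  let ι : s → S := fun x ↦ ⟨x.1.1, x.2⟩
  have hι : Function.Injective ι := fun x y h ↦ Subtype.ext (Subtype.ext (congrArg (·.1) h))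
  have : Finite s := Finite.of_injective ι hι
  have hcard' : Nat.card s ≤ r := by
    refine le_trans ?_ hcard
    simpa using Nat.card_le_card_of_injective ι hι
  have key := FreeGroup.index_mul_le_of_mulEquiv _ _ e hcl
  have h1 : (G.comap ψ).index * ψ.range.index = (ψ.range.subgroupOf G).index * G.index := by
    rw [Subgroup.index_comap, ← Subgroup.inf_relIndex_right,
      Subgroup.relIndex_mul_index inf_le_right, ← Subgroup.relIndex, ← Subgroup.inf_relIndex_left,
      Subgroup.relIndex_mul_index inf_le_left]
  have hj : 0 < (ψ.range.subgroupOf G).index :=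
    Nat.pos_of_ne_zero Subgroup.FiniteIndex.index_ne_zero
  obtain ⟨k, rfl⟩ : ∃ k, r = k + 1 := ⟨r - 1, by omega⟩
  simp only [Nat.card_eq_fintype_card, Fintype.card_bool, add_tsub_cancel_right] at key ⊢
  have hm : (G.comap ψ).index ≤ k * (ψ.range.subgroupOf G).index := by
    have := Nat.mul_le_mul_right (ψ.range.subgroupOf G).index hcard'
    rw [add_mul] at this
    omega
  refine Nat.le_of_mul_le_mul_left ?_ hj
  calc _ = (G.comap ψ).index * ψ.range.index := h1.symm
    _ ≤ (k * (ψ.range.subgroupOf G).index) * 12 := Nat.mul_le_mul hm hc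
    _ = _ := by ring
end

section
/- Let Π be a group that can be generated by r elements, where r ≥ 2, and let ρ : Π → SL(2,ℤ) be a group homomorphism whose image G = im(ρ) has finite index in SL(2,ℤ). Then (SL(2,ℤ) : G) ≤ 12(r − 1). -/
/-- `Γ` is the free product of the subgroup of order two generated by `s` and the subgroup
of order three generated by `u`. -/
structure IsFreeProductTwoThree {Γ : Type} [Group Γ] (s u : Γ) : Prop where
  closure_eq_top : Subgroup.closure {s, u} = ⊤
  sq_eq_one : s ^ 2 = 1
  cube_eq_one : u ^ 3 = 1
  exists_lift : ∀ {H : Type} [Group H] (a b : H), a ^ 2 = 1 → b ^ 3 = 1 →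
    ∃ φ : Γ →* H, φ s = a ∧ φ u = b

/-- A crossed homomorphism from `Γ` to the sign functions on a `Γ`-set `Z`. -/
def IsSignCocycle {Γ Z : Type} [Group Γ] [MulAction Γ Z] (c : Γ → Z → ℤˣ) : Prop :=
  ∀ g h z, c (g * h) z = c g z * c h (g⁻¹ • z)

namespace IsSignCocycle

variable {Γ : Type} [Group Γ]

theorem one {Z : Type} [MulAction Γ Z] {c : Γ → Z → ℤˣ} (hc : IsSignCocycle c) (z : Z) :
    c 1 z = 1 := by
  simpa using hc 1 1 z

theorem inv {Z : Type} [MulAction Γ Z] {c : Γ → Z → ℤˣ} (hc : IsSignCocycle c) (g : Γ) (z : Z) :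
    c g⁻¹ z = (c g (g • z))⁻¹ := by
  have h := hc g g⁻¹ (g • z)
  rw [mul_inv_cancel, hc.one, inv_smul_smul] at h
  exact eq_inv_of_mul_eq_one_right h.symm

/-- A cocycle on `X × Y`, with `X` transitive, is determined by its values over a base point of `X`
at generators of the stabilizer and at a transversal. -/
theorem eq_of_eq_on_fiber {X Y : Type} [MulAction Γ X] [MulAction Γ Y] {c c' : Γ → X × Y → ℤˣ}
    (hc : IsSignCocycle c) (hc' : IsSignCocycle c') (x₀ : X) {T : Set Γ}
    (hT : Subgroup.closure T = MulAction.stabilizer Γ x₀) (t : X → Γ)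
    (ht : ∀ x, t x • x = x₀)
    (hfix : ∀ g ∈ T, ∀ y, c g (x₀, y) = c' g (x₀, y))
    (htrans : ∀ x, x ≠ x₀ → ∀ y, c (t x) (x₀, y) = c' (t x) (x₀, y)) : c = c' := by
  have hstab : ∀ g ∈ MulAction.stabilizer Γ x₀, ∀ y, c g (x₀, y) = c' g (x₀, y) := by
    intro g hg
    rw [← hT] at hg
    induction hg using Subgroup.closure_induction with
    | mem g hg => exact hfix g hg
    | one => intro y; rw [hc.one, hc'.one]
    | mul g h hg hh ihg ihh =>
      intro y
      have hgx : g⁻¹ • x₀ = x₀ := inv_mem (hT ▸ hg : g ∈ MulAction.stabilizer Γ x₀)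
      rw [hc, hc', Prod.smul_mk, hgx, ihg, ihh]
    | inv g hg ih =>
      intro y
      have hgx : g • x₀ = x₀ := (hT ▸ hg : g ∈ MulAction.stabilizer Γ x₀)
      rw [hc.inv, hc'.inv, Prod.smul_mk, hgx, ih]
  have htrans' : ∀ x y, c (t x) (x₀, y) = c' (t x) (x₀, y) := by
    intro x
    by_cases hx : x = x₀
    · exact hstab _ (by simpa [hx] using ht x)
    · exact htrans x hx
  have hbase : ∀ g y, c g (x₀, y) = c' g (x₀, y) := by
    intro g y
    set k := t (g⁻¹ • x₀) with hk
    have hm : (g * k⁻¹)⁻¹ • x₀ = x₀ := by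
      rw [mul_inv_rev, inv_inv, mul_smul, hk, ht]
    have hg : g = g * k⁻¹ * k := by group
    rw [hg, hc, hc', Prod.smul_mk, hm, hstab _ (inv_mem_iff.1 (MulAction.mem_stabilizer_iff.2 hm)),
      htrans']
  funext g ⟨x, y⟩
  have h1 := hc (t x) g (x₀, t x • y)
  have h2 := hc' (t x) g (x₀, t x • y)
  have hx : (t x)⁻¹ • x₀ = x := by rw [← ht x, inv_smul_smul]
  rw [Prod.smul_mk, hx, inv_smul_smul] at h1 h2
  rw [hbase, hbase, h2] at h1
  exact (mul_left_cancel h1).symm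

end IsSignCocycle

namespace IsFreeProductTwoThree

variable {Γ : Type} [Group Γ] {s u : Γ}

theorem exists_cocycle (h : IsFreeProductTwoThree s u) {Z : Type} [MulAction Γ Z] (a b : Z → ℤˣ)
    (ha : ∀ z, a z * a (s⁻¹ • z) = 1) (hb : ∀ z, b z * b (u⁻¹ • z) * b (u⁻¹ • u⁻¹ • z) = 1) :
    ∃ c : Γ → Z → ℤˣ, IsSignCocycle c ∧ c s = a ∧ c u = b := by
  have haut : ∀ (g : Γ) (f : Z → ℤˣ) (z : Z), mulAutArrow g f z = f (g⁻¹ • z) := fun _ _ _ => rfl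
  obtain ⟨φ, hs, hu⟩ := h.exists_lift (H := (Z → ℤˣ) ⋊[mulAutArrow] Γ) ⟨a, s⟩ ⟨b, u⟩
    (by
      refine SemidirectProduct.ext (funext fun z => ?_) ?_
      · rw [pow_two, SemidirectProduct.mul_left, Pi.mul_apply, haut]
        exact ha z
      · rw [pow_two, SemidirectProduct.mul_right]
        exact (pow_two s).symm.trans h.sq_eq_one)
    (by
      refine SemidirectProduct.ext (funext fun z => ?_) ?_
      · simp only [pow_succ, pow_zero, one_mul, SemidirectProduct.mul_left,
          SemidirectProduct.mul_right, Pi.mul_apply, haut, mul_inv_rev, mul_smul]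
        exact hb z
      · rw [pow_three, SemidirectProduct.mul_right, SemidirectProduct.mul_right]
        exact (pow_three u).symm.trans h.cube_eq_one)
  have hright : SemidirectProduct.rightHom.comp φ = MonoidHom.id Γ := by
    refine MonoidHom.eq_of_eqOn_dense h.closure_eq_top ?_
    rintro g (rfl | rfl) <;> simp [hs, hu]
  have hr : ∀ g, (φ g).right = g := fun g => DFunLike.congr_fun hright g
  refine ⟨fun g => (φ g).left, fun g k z => ?_, by simp [hs], by simp [hu]⟩
  simp only [map_mul, SemidirectProduct.mul_left, Pi.mul_apply, haut, hr]

/-- Restriction of the norms of `a` under `s` and of `b` under `u` to fundamental domains. -/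
def normHom {X : Type} [MulAction Γ X] (s u : Γ) :
    (X × ZMod 2 × ZMod 3 → ℤˣ) × (X × ZMod 2 × ZMod 3 → ℤˣ) →*
      (X × ZMod 3 → ℤˣ) × (X × ZMod 2 → ℤˣ) where
  toFun p :=
    (fun x => p.1 (x.1, 0, x.2) * p.1 (s⁻¹ • x.1, 1, x.2),
      fun x => p.2 (x.1, x.2, 0) * p.2 (u⁻¹ • x.1, x.2, 2) * p.2 (u⁻¹ • u⁻¹ • x.1, x.2, 1))
  map_one' := by ext <;> simp
  map_mul' p q := by
    refine Prod.ext (funext fun x => ?_) (funext fun x => ?_)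
    · exact mul_mul_mul_comm _ _ _ _
    · simp only [Prod.snd_mul, Pi.mul_apply]
      ac_rfl

theorem exists_cocycle_of_mem_ker (h : IsFreeProductTwoThree s u) {X : Type} [MulAction Γ X]
    [MulAction Γ (ZMod 2 × ZMod 3)] (hs : ∀ y : ZMod 2 × ZMod 3, s • y = (1, 0) + y)
    (hu : ∀ y : ZMod 2 × ZMod 3, u • y = (0, 1) + y)
    {p : (X × ZMod 2 × ZMod 3 → ℤˣ) × (X × ZMod 2 × ZMod 3 → ℤˣ)}
    (hp : p ∈ (normHom (X := X) s u).ker) :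
    ∃ c : Γ → X × ZMod 2 × ZMod 3 → ℤˣ, IsSignCocycle c ∧ c s = p.1 ∧ c u = p.2 := by
  obtain ⟨a, b⟩ := p
  have hs' : ∀ i j, s⁻¹ • ((i, j) : ZMod 2 × ZMod 3) = (i + 1, j) := by
    intro i j
    rw [inv_smul_eq_iff, hs]
    revert i j; decide
  have hu' : ∀ i j, u⁻¹ • ((i, j) : ZMod 2 × ZMod 3) = (i, j + 2) := by
    intro i j
    rw [inv_smul_eq_iff, hu]
    revert i j; decide
  have hss : ∀ x : X, s⁻¹ • s⁻¹ • x = x := by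
    intro x
    rw [smul_smul, ← mul_inv_rev, ← pow_two, h.sq_eq_one, inv_one, one_smul]
  have huuu : ∀ x : X, u⁻¹ • u⁻¹ • u⁻¹ • x = x := by
    intro x
    rw [smul_smul, smul_smul, ← mul_inv_rev, ← mul_inv_rev, ← pow_three, h.cube_eq_one,
      inv_one, one_smul]
  have hp' := MonoidHom.mem_ker.1 hp
  have ha : ∀ x j, a (x, 0, j) * a (s⁻¹ • x, 1, j) = 1 := fun x j =>
    congrFun (congrArg Prod.fst hp') (x, j)
  have hb : ∀ x i, b (x, i, 0) * b (u⁻¹ • x, i, 2) * b (u⁻¹ • u⁻¹ • x, i, 1) = 1 := fun x i =>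
    congrFun (congrArg Prod.snd hp') (x, i)
  refine h.exists_cocycle a b ?_ ?_
  · rintro ⟨x, i, j⟩
    simp only [Prod.smul_mk, hs']
    fin_cases i
    · exact ha x j
    · have := ha (s⁻¹ • x) j
      rw [hss, mul_comm] at this
      exact this
  · rintro ⟨x, i, j⟩
    simp only [Prod.smul_mk, hu']
    fin_cases j
    · exact hb x i
    · have := hb (u⁻¹ • x) i
      rw [huuu, mul_comm, ← mul_assoc] at this
      exact this
    · have := hb (u⁻¹ • u⁻¹ • x) i
      rw [huuu, mul_assoc, mul_comm] at this
      exact this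

theorem exists_smul_zmod (h : IsFreeProductTwoThree s u) :
    ∃ _ : MulAction Γ (ZMod 2 × ZMod 3),
      (∀ y : ZMod 2 × ZMod 3, s • y = (1, 0) + y) ∧
        ∀ y : ZMod 2 × ZMod 3, u • y = (0, 1) + y := by
  obtain ⟨χ, hs, hu⟩ := h.exists_lift (H := Multiplicative (ZMod 2 × ZMod 3))
    (Multiplicative.ofAdd (1, 0)) (Multiplicative.ofAdd (0, 1)) (by decide) (by decide)
  refine ⟨MulAction.compHom _ χ, fun y => ?_, fun y => ?_⟩
  · exact congrArg (· • y) hs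
  · exact congrArg (· • y) hu

theorem card_add_six_le (h : IsFreeProductTwoThree s u) (X : Type) [Finite X] [MulAction Γ X]
    [MulAction.IsPretransitive Γ X] (x₀ : X) (T : Finset Γ)
    (hT : Subgroup.closure (T : Set Γ) = MulAction.stabilizer Γ x₀) :
    Nat.card X + 6 ≤ 6 * T.card := by
  classical
  have := Fintype.ofFinite X
  obtain ⟨_, hs, hu⟩ := h.exists_smul_zmod
  choose t ht using fun x : X => MulAction.exists_smul_eq Γ x x₀
  let K := (normHom (X := X) s u).ker
  choose c hc hcs hcu using fun p : K => h.exists_cocycle_of_mem_ker hs hu p.2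
  let F : K → (T × ZMod 2 × ZMod 3 → ℤˣ) × ({x // x ≠ x₀} × ZMod 2 × ZMod 3 → ℤˣ) := fun p =>
    (fun q => c p q.1 (x₀, q.2), fun q => c p (t q.1) (x₀, q.2))
  have hF : Function.Injective F := by
    intro p q hpq
    have hcc : c p = c q := (hc p).eq_of_eq_on_fiber (hc q) x₀ hT t ht
      (fun g hg y => congrFun (congrArg Prod.fst hpq) (⟨g, hg⟩, y))
      (fun x hx y => congrFun (congrArg Prod.snd hpq) (⟨x, hx⟩, y))
    refine Subtype.ext (Prod.ext ?_ ?_)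
    · rw [← hcs, hcc, hcs]
    · rw [← hcu, hcc, hcu]
  have h1 := Nat.card_le_card_of_injective F hF
  have h2 := K.card_mul_index
  rw [Subgroup.index_ker] at h2
  have h3 := Subgroup.card_le_card_group (normHom (X := X) s u).range
  have h4 := Nat.mul_le_mul h1 h3
  rw [h2] at h4
  simp only [Nat.card_eq_fintype_card, Fintype.card_prod, Fintype.card_fun, ZMod.card,
    Fintype.card_units_int, Fintype.card_coe, ← pow_add] at h4 ⊢
  have h5 := (Nat.pow_le_pow_iff_right (by norm_num)).1 h4
  have h6 : Fintype.card {x // x ≠ x₀} + 1 = Fintype.card X := by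
    have := Fintype.card_subtype_compl (fun x => x = x₀)
    have hpos := Fintype.card_pos_iff.2 ⟨x₀⟩
    rw [Fintype.card_subtype_eq] at this
    simp only [ne_eq]
    omega
  omega

theorem index_add_six_le (h : IsFreeProductTwoThree s u) (T : Finset Γ)
    (hfin : (Subgroup.closure (T : Set Γ)).index ≠ 0) :
    (Subgroup.closure (T : Set Γ)).index + 6 ≤ 6 * T.card := by
  have : (Subgroup.closure (T : Set Γ)).FiniteIndex := ⟨hfin⟩
  exact h.card_add_six_le (Γ ⧸ Subgroup.closure (T : Set Γ)) (1 : Γ) T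
    (MulAction.stabilizer_quotient _).symm

end IsFreeProductTwoThree

/-- The homomorphism from a cyclic group of order `n` determined by an element with `g ^ n = 1`. -/
def zmodPowersHom {G : Type} [Group G] (n : ℕ) (g : G) (hg : g ^ n = 1) :
    Multiplicative (ZMod n) →* G :=
  AddMonoidHom.toMultiplicativeLeft (ZMod.lift n ⟨zmultiplesHom (Additive G) (.ofMul g), by
    simpa using congrArg Additive.ofMul hg⟩)

theorem zmodPowersHom_ofAdd_natCast {G : Type} [Group G] (n : ℕ) (g : G) (hg : g ^ n = 1) (k : ℕ) :
    zmodPowersHom n g hg (.ofAdd (k : ZMod n)) = g ^ k := by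
  have h : ((k : ℤ) : ZMod n) = k := by norm_cast
  rw [zmodPowersHom, ← h]
  change (ZMod.lift n ⟨zmultiplesHom (Additive G) (.ofMul g), _⟩ ((k : ℤ) : ZMod n)).toMul = g ^ k
  rw [ZMod.lift_coe]
  simp

namespace IsFreeProductTwoThree

/-- Ping-pong for an element of order two and an element of order three. -/
theorem of_ping_pong {G α : Type} [Group G] [MulAction G α] {s u : G}
    (hgen : Subgroup.closure {s, u} = ⊤) (hs : s ^ 2 = 1) (hu : u ^ 3 = 1) (A B : Set α)
    (hA : A.Nonempty) (hB : B.Nonempty) (hAB : Disjoint A B)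
    (hsB : ∀ z ∈ B, s • z ∈ A) (huA : ∀ z ∈ A, u • z ∈ B) (huuA : ∀ z ∈ A, u ^ 2 • z ∈ B) :
    IsFreeProductTwoThree s u := by
  let C : Fin 2 → Type := fun i => Multiplicative (ZMod (![2, 3] i))
  have hpow : ∀ {H : Type} [Group H] (a b : H), a ^ 2 = 1 → b ^ 3 = 1 →
      ∀ i, (![a, b] i) ^ (![2, 3] i : ℕ) = 1 := by
    intro H _ a b ha hb i
    fin_cases i <;> simpa
  let f : ∀ i, C i →* G := fun i => zmodPowersHom _ _ (hpow s u hs hu i)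
  have hinj : Function.Injective (Monoid.CoprodI.lift f) := by
    refine Monoid.CoprodI.lift_injective_of_ping_pong f (Or.inr ⟨1, ?_⟩) ![A, B] ?_ ?_ ?_
    · change 3 ≤ Cardinal.mk (ZMod 3)
      simp
    · intro i
      fin_cases i <;> assumption
    · intro i j hij
      fin_cases i <;> fin_cases j
      · exact absurd rfl hij
      · exact hAB
      · exact hAB.symm
      · exact absurd rfl hij
    · intro i j hij x hx
      fin_cases i <;> fin_cases j
      · exact absurd rfl hij
      · have hx1 : x = .ofAdd ((1 : ℕ) : ZMod 2) := by
          revert x; change ∀ x : ZMod 2, x ≠ 0 → x = 1; decide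
        rintro _ ⟨z, hz, rfl⟩
        have hfx : f 0 x = s := by
          rw [hx1]
          exact (zmodPowersHom_ofAdd_natCast 2 s hs 1).trans (pow_one s)
        change f 0 x • z ∈ A
        rw [hfx]
        exact hsB z hz
      · have hx1 : x = .ofAdd ((1 : ℕ) : ZMod 3) ∨ x = .ofAdd ((2 : ℕ) : ZMod 3) := by
          revert x; change ∀ x : ZMod 3, x ≠ 0 → x = 1 ∨ x = 2; decide
        rintro _ ⟨z, hz, rfl⟩
        change f 1 x • z ∈ B
        rcases hx1 with rfl | rfl
        · have hfx : f 1 (.ofAdd ((1 : ℕ) : ZMod 3)) = u :=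
            (zmodPowersHom_ofAdd_natCast 3 u hu 1).trans (pow_one u)
          rw [hfx]
          exact huA z hz
        · have hfx : f 1 (.ofAdd ((2 : ℕ) : ZMod 3)) = u ^ 2 :=
            zmodPowersHom_ofAdd_natCast 3 u hu 2
          rw [hfx]
          exact huuA z hz
      · exact absurd rfl hij
  let g : Fin 2 → Monoid.CoprodI C := fun i => .of (i := i) (.ofAdd ((1 : ℕ) : ZMod _))
  have hg : ∀ {H : Type} [Group H] (a b : H) (ha : a ^ 2 = 1) (hb : b ^ 3 = 1) (i : Fin 2),
      Monoid.CoprodI.lift (fun i => (zmodPowersHom _ _ (hpow a b ha hb i) : C i →* H)) (g i) =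
        ![a, b] i := by
    intro H _ a b ha hb i
    rw [Monoid.CoprodI.lift_of, zmodPowersHom_ofAdd_natCast, pow_one]
  have hsurj : Function.Surjective (Monoid.CoprodI.lift f) := by
    rw [← MonoidHom.range_eq_top, eq_top_iff, ← hgen, Subgroup.closure_le]
    rintro _ (rfl | rfl)
    · exact ⟨g 0, hg _ _ hs hu 0⟩
    · exact ⟨g 1, hg _ _ hs hu 1⟩
  let e : Monoid.CoprodI C ≃* G := MulEquiv.ofBijective (Monoid.CoprodI.lift f) ⟨hinj, hsurj⟩
  have he0 : e.symm s = g 0 := (e.symm_apply_eq).2 (hg s u hs hu 0).symm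
  have he1 : e.symm u = g 1 := (e.symm_apply_eq).2 (hg s u hs hu 1).symm
  refine ⟨hgen, hs, hu, fun {H} _ a b ha hb => ⟨(Monoid.CoprodI.lift fun i =>
    (zmodPowersHom _ _ (hpow a b ha hb i) : C i →* H)).comp e.symm.toMonoidHom, ?_, ?_⟩⟩
  · exact (congrArg _ he0).trans (hg a b ha hb 0)
  · exact (congrArg _ he1).trans (hg a b ha hb 1)

end IsFreeProductTwoThree

theorem relIndex_sup_le_card {G : Type*} [Group G] (H K : Subgroup G) [K.Normal] [Finite K] :
    H.relIndex (H ⊔ K) ≤ Nat.card K := by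
  refine Nat.card_le_card_of_surjective
    (fun k : K => (⟨k, Subgroup.mem_sup_right k.2⟩ : ↥(H ⊔ K)) : K → _ ⧸ H.subgroupOf (H ⊔ K)) ?_
  rintro ⟨x, hx⟩
  obtain ⟨k, hk, h, hh, rfl⟩ := Subgroup.mem_sup_of_normal_left.1 (sup_comm H K ▸ hx)
  refine ⟨⟨k, hk⟩, QuotientGroup.eq.2 ?_⟩
  simpa [Subgroup.mem_subgroupOf] using hh

section ModularGroup

open scoped MatrixGroups UpperHalfPlane
open ModularGroup UpperHalfPlane

theorem modular_S_smul_re (z : ℍ) : (S • z).re = -z.re / Complex.normSq z := by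
  rw [modular_S_smul]
  simp [neg_div]

theorem modular_S_smul_re_pos {z : ℍ} (hz : z.re < 0) : 0 < (S • z).re := by
  rw [modular_S_smul_re]
  exact div_pos (neg_pos.2 hz) (normSq_pos z)

theorem modular_S_smul_re_neg {z : ℍ} (hz : 0 < z.re) : (S • z).re < 0 := by
  rw [modular_S_smul_re]
  exact div_neg_of_neg_of_pos (neg_lt_zero.2 hz) (normSq_pos z)

theorem modular_T_mul_S_smul_re_pos {z : ℍ} (hz : z.re < 0) : 0 < ((T * S) • z).re := by
  rw [mul_smul, modular_T_smul, vadd_re]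
  linarith [modular_S_smul_re_pos hz]

theorem modular_T_mul_S_sq_smul_re_pos {z : ℍ} (hz : z.re < 0) : 0 < ((T * S) ^ 2 • z).re := by
  rw [show (T * S) ^ 2 = S * T ^ (-1 : ℤ) by decide, mul_smul]
  refine modular_S_smul_re_pos ?_
  rw [modular_T_zpow_smul, vadd_re]
  push_cast
  linarith

theorem eq_one_or_eq_neg_one_of_forall_smul_eq {g : SL(2, ℤ)} (h : ∀ z : ℍ, g • z = z) :
    g = 1 ∨ g = -1 := by
  have key : ∀ z : ℍ, (g 0 0 : ℂ) * z + g 0 1 = z * (g 1 0 * z + g 1 1) := by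
    intro z
    have hz := congrArg UpperHalfPlane.coe (h z)
    rw [coe_specialLinearGroup_apply] at hz
    simp only [algebraMap_int_eq, eq_intCast, Complex.ofReal_intCast] at hz
    exact (div_eq_iff fun h0 => z.ne_zero (by rw [← hz, h0, div_zero])).1 hz
  have h1 := key I
  have h2 := key ⟨2 * Complex.I, by simp⟩
  simp [Complex.ext_iff] at h1 h2
  obtain ⟨h1, h1'⟩ := h1
  replace h2 := h2.1
  norm_cast at h1 h1'
  have hc : g 1 0 = 0 := by
    have h3 : (g 0 1 : ℝ) = -g 1 0 := by exact_mod_cast h1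
    have h4 : (g 1 0 : ℝ) = 0 := by linarith
    exact_mod_cast h4
  have hb : g 0 1 = 0 := by rw [h1, hc, neg_zero]
  have hdet := Matrix.det_fin_two g.1
  rw [g.2, h1', hc, hb] at hdet
  have hsq : g 1 1 * g 1 1 = 1 := by linarith
  rcases Int.mul_eq_one_iff_eq_one_or_neg_one.1 hsq with ⟨hd, -⟩ | ⟨hd, -⟩
  · left
    ext i j
    fin_cases i <;> fin_cases j <;> simp [h1', hc, hb, hd]
  · right
    ext i j
    fin_cases i <;> fin_cases j <;> simp [h1', hc, hb, hd]

theorem card_ker_toPermHom_le_two :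
    Finite (MulAction.toPermHom SL(2, ℤ) ℍ).ker ∧
      Nat.card (MulAction.toPermHom SL(2, ℤ) ℍ).ker ≤ 2 := by
  have hsub : ((MulAction.toPermHom SL(2, ℤ) ℍ).ker : Set SL(2, ℤ)) ⊆ {1, -1} := fun g hg =>
    eq_one_or_eq_neg_one_of_forall_smul_eq fun z => DFunLike.congr_fun (MonoidHom.mem_ker.1 hg) z
  refine ⟨(Set.toFinite {1, -1}).subset hsub, ?_⟩
  exact (Set.ncard_le_ncard hsub).trans (Set.ncard_insert_le _ _ |>.trans (by simp))

theorem isFreeProductTwoThree_modular :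
    IsFreeProductTwoThree ((MulAction.toPermHom SL(2, ℤ) ℍ).rangeRestrict S)
      ((MulAction.toPermHom SL(2, ℤ) ℍ).rangeRestrict (T * S)) := by
  have hneg : (MulAction.toPermHom SL(2, ℤ) ℍ).rangeRestrict (-1) = 1 :=
    Subtype.ext (Equiv.ext fun z => (SL_neg_smul 1 z).trans (one_smul _ z))
  refine .of_ping_pong ?_ ?_ ?_ {z : ℍ | z.re < 0} {z : ℍ | 0 < z.re} ?_ ?_ ?_
    (fun z hz => modular_S_smul_re_neg hz) (fun z hz => modular_T_mul_S_smul_re_pos hz)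
    (fun z hz => ?_)
  · have hST : Subgroup.closure {S, T * S} = ⊤ := by
      rw [eq_top_iff, ← SpecialLinearGroup.SL2Z_generators, Subgroup.closure_le]
      have hS : S ∈ Subgroup.closure {S, T * S} := Subgroup.subset_closure (by simp)
      have hTS : T * S ∈ Subgroup.closure {S, T * S} := Subgroup.subset_closure (by simp)
      rintro _ (rfl | rfl)
      · exact hS
      · exact (Subgroup.mul_mem_cancel_right _ hS).1 hTS
    rw [← Set.image_pair, ← MonoidHom.map_closure, hST, ← MonoidHom.range_eq_map,
      MonoidHom.range_eq_top]
    exact MonoidHom.rangeRestrict_surjective _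
  · rw [← map_pow, show S ^ 2 = -1 by decide, hneg]
  · rw [← map_pow, show (T * S) ^ 3 = -1 by decide, hneg]
  · exact ⟨⟨-1 + Complex.I, by simp⟩, by simp [← coe_re]⟩
  · exact ⟨⟨1 + Complex.I, by simp⟩, by simp [← coe_re]⟩
  · exact Set.disjoint_left.2 fun z hz hz' => lt_asymm (show z.re < 0 from hz) hz'
  · rw [← map_pow]
    exact modular_T_mul_S_sq_smul_re_pos hz

end ModularGroup


/-- **Proposition 5.5 (group-theoretic content).** If a group `P` can be
generated by `r ≥ 2` elements and `ρ : P → SL(2,ℤ)` is a homomorphism whose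
image has finite index in `SL(2,ℤ)`, then `(SL(2,ℤ) : im ρ) ≤ 12(r-1)`. -/
theorem stmt_7 {P : Type*} [Group P] (r : ℕ) (hr : 2 ≤ r)
    (S : Finset P) (hcard : S.card ≤ r)
    (hgen : Subgroup.closure (S : Set P) = (⊤ : Subgroup P))
    (ρ : P →* Matrix.SpecialLinearGroup (Fin 2) ℤ)
    (hfin : ρ.range.index ≠ 0) :
    ρ.range.index ≤ 12 * (r - 1) := by
  classical
  let f := MulAction.toPermHom (Matrix.SpecialLinearGroup (Fin 2) ℤ) UpperHalfPlane
  obtain ⟨hker, hcardker⟩ := card_ker_toPermHom_le_two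
  have hmap : ρ.range.map f.rangeRestrict =
      Subgroup.closure (S.image (f.rangeRestrict.comp ρ) : Set f.range) := by
    rw [Finset.coe_image, ← MonoidHom.map_closure, hgen, ← Subgroup.map_map,
      ← MonoidHom.range_eq_map ρ]
  have hindex : (ρ.range.map f.rangeRestrict).index = (ρ.range ⊔ f.ker).index := by
    rw [Subgroup.index_map, MonoidHom.range_eq_top.2 f.rangeRestrict_surjective,
      Subgroup.index_top, mul_one, MonoidHom.ker_rangeRestrict]
  have hmul := Subgroup.relIndex_mul_index (le_sup_left : ρ.range ≤ ρ.range ⊔ f.ker)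
  have hrel : ρ.range.relIndex (ρ.range ⊔ f.ker) ≤ 2 :=
    (relIndex_sup_le_card ρ.range f.ker).trans hcardker
  have hne : (ρ.range ⊔ f.ker).index ≠ 0 := fun h0 => hfin (by rw [← hmul, h0, mul_zero])
  rw [← hindex, hmap] at hne
  have hle := isFreeProductTwoThree_modular.index_add_six_le _ hne
  rw [← hmap, hindex] at hle
  have hcard' := (Finset.card_image_le (s := S) (f := f.rangeRestrict.comp ρ)).trans hcard
  have hprod := Nat.mul_le_mul_right (ρ.range ⊔ f.ker).index hrel
  omega
end

section
/- Let p, q ∈ ℂ with p ≠ 0, q ≠ 0 and 4p³ + 27q² ≠ 0. Set j = 1728 · 4p³/(4p³ + 27q²) and λ = q/p. Then j ≠ 0, j ≠ 1728, and p = λ² / ((4/27)·(1728/j − 1)) and q = λ³ / ((4/27)·(1728/j − 1)). -/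
/-- From the proof of **Proposition 5.2**: for `p, q ∈ ℂ` with `p ≠ 0`, `q ≠ 0`
and `4p³ + 27q² ≠ 0`, setting `j = 1728·4p³/(4p³+27q²)` and `λ = q/p`, one has
`j ≠ 0`, `j ≠ 1728`, and `p` and `q` are recovered by the stated formulas. -/
theorem stmt_11 (p q : ℂ) (hp : p ≠ 0) (hq : q ≠ 0)
    (hΔ : 4 * p ^ 3 + 27 * q ^ 2 ≠ 0)
    (j l : ℂ)
    (hj : j = 1728 * (4 * p ^ 3) / (4 * p ^ 3 + 27 * q ^ 2))
    (hl : l = q / p) :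
    j ≠ 0 ∧ j ≠ 1728
      ∧ p = l ^ 2 / ((4 / 27) * (1728 / j - 1))
      ∧ q = l ^ 3 / ((4 / 27) * (1728 / j - 1)) := by
  have hden : (4 / 27) * (1728 / j - 1) = q ^ 2 / p ^ 3 := by
    rw [hj]
    field_simp
    ring
  refine ⟨?_, ?_, ?_, ?_⟩
  · rw [hj]
    exact div_ne_zero (by simp [hp]) hΔ
  · rintro rfl
    have hne : q ^ 2 / p ^ 3 ≠ 0 := div_ne_zero (pow_ne_zero 2 hq) (pow_ne_zero 3 hp)
    exact hne (by rw [← hden]; norm_num)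
  · rw [hden, hl]
    field_simp
  · rw [hden, hl]
    field_simp
end
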